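/- arXiv:1811.10430 — 3 statements merged into one kernel-verified Lean document; each statement's English description precedes it below -/
import Mathlib

section
/- Let L be an n×n real Laplacian matrix, v ∈ ℝⁿ a vector with nonnegative entries, s = Σᵢ vᵢ, and δ > 0. Define the (n+1)×(n+1) matrices L₀ = [[L, 0],[0ᵀ, 0]], H_I = [[Iₙ, −𝟏],[0ᵀ, 0]], H_v = [[0_{n×n}, 0],[−vᵀ, s]], and H_{δ,v} = δ H_I + H_v, where 𝟏 is the all-ones vector in ℝⁿ. Then the eigenprojection of L₀ + H_{δ,v} at eigenvalue 0 equals 𝟏' · (1/(s+δ)) · [vᵀ(I + (1/δ)L)^{−1}, δ], i.e., the rank-one matrix whose every row is the (n+1)-row-vector (1/(s+δ))·(vᵀ(I + (1/δ)L)^{−1}, δ); here 𝟏' is the all-ones column vector in ℝ^{n+1}. -/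
open Matrix Filter Topology

/-- `L` is the Laplacian matrix of a weighted digraph: off-diagonal entries are
nonpositive and every row sum is zero. -/
def IsLaplacian {m : Type*} [Fintype m] [DecidableEq m] (L : Matrix m m ℝ) : Prop :=
  (∀ i j, i ≠ j → L i j ≤ 0) ∧ (∀ i, ∑ j, L i j = 0)

/-- `P` is the eigenprojection of the square matrix `M` at eigenvalue `0`:
`P` is idempotent, its range is the kernel of `M ^ k` and its kernel is the range
of `M ^ k`, where `k` is the size of the matrix. -/
def IsEigenprojection {m : Type*} [Fintype m] [DecidableEq m] (M P : Matrix m m ℝ) : Prop :=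
  P * P = P ∧
  LinearMap.range P.mulVecLin = LinearMap.ker (M ^ Fintype.card m).mulVecLin ∧
  LinearMap.ker P.mulVecLin = LinearMap.range (M ^ Fintype.card m).mulVecLin

/-- If `M` and `P` annihilate each other, `P` is idempotent and `P` fixes the kernel of `M`,
then `P` is the eigenprojection of `M` at `0`. -/
theorem isEigenprojection_of_mul_eq_zero {m : Type*} [Fintype m] [DecidableEq m] [Nonempty m]
    {M P : Matrix m m ℝ} (hP : P * P = P) (hMP : M * P = 0) (hPM : P * M = 0)
    (hker : ∀ x, M *ᵥ x = 0 → P *ᵥ x = x) : IsEigenprojection M P := by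
  obtain ⟨k, hk⟩ := Nat.exists_eq_succ_of_ne_zero (Fintype.card_ne_zero (α := m))
  have hMkP : M ^ (k + 1) * P = 0 := by rw [pow_succ, mul_assoc, hMP, mul_zero]
  have hPMk : ∀ j, P * M ^ (j + 1) = 0 := fun j => by
    rw [pow_succ', ← mul_assoc, hPM, zero_mul]
  have hkerk : ∀ j x, M ^ (j + 1) *ᵥ x = 0 → P *ᵥ x = x := by
    intro j
    induction j with
    | zero => simpa using hker
    | succ j ih =>
      intro x hx
      apply ih
      rw [pow_succ', ← mulVec_mulVec] at hx
      rw [← hker _ hx, mulVec_mulVec, hPMk, zero_mulVec]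
  refine ⟨hP, ?_, ?_⟩ <;> rw [hk, Nat.succ_eq_add_one]
  · ext x
    simp only [LinearMap.mem_range, LinearMap.mem_ker, mulVecLin_apply]
    constructor
    · rintro ⟨y, rfl⟩
      rw [mulVec_mulVec, hMkP, zero_mulVec]
    · exact fun hx => ⟨x, hkerk k x hx⟩
  · ext x
    simp only [LinearMap.mem_range, LinearMap.mem_ker, mulVecLin_apply]
    constructor
    · intro hx
      have hPN : P * (M ^ (k + 1) + P) = P := by rw [mul_add, hPMk, hP, zero_add]
      have hinj : Function.Injective (M ^ (k + 1) + P).mulVecLin := by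
        rw [injective_iff_map_eq_zero]
        intro y hy
        rw [mulVecLin_apply] at hy
        have hPy : P *ᵥ y = 0 := by rw [← hPN, ← mulVec_mulVec, hy, mulVec_zero]
        rw [add_mulVec, hPy, add_zero] at hy
        rw [← hkerk k y hy, hPy]
      obtain ⟨y, rfl⟩ := LinearMap.surjective_of_injective hinj x
      rw [mulVecLin_apply, mulVec_mulVec, hPN] at hx
      exact ⟨y, by rw [mulVecLin_apply, add_mulVec, hx, add_zero]⟩
    · rintro ⟨y, rfl⟩
      rw [mulVec_mulVec, hPMk, zero_mulVec]

/-- If the all-ones vector spans the kernel of `M` and `w` is a left null vector of `M` whose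
entries sum to one, then the matrix with all rows equal to `w` is the eigenprojection of `M`. -/
theorem isEigenprojection_of_vecMul_eq_zero {m : Type*} [Fintype m] [DecidableEq m] [Nonempty m]
    {M : Matrix m m ℝ} {w : m → ℝ} (hM : M *ᵥ 1 = 0) (hw : w ᵥ* M = 0) (hw1 : w ⬝ᵥ 1 = 1)
    (hker : ∀ x, M *ᵥ x = 0 → ∃ t : ℝ, x = t • 1) :
    IsEigenprojection M (Matrix.of fun _ j => w j) := by
  have hvec : (Matrix.of fun _ j => w j : Matrix m m ℝ) = vecMulVec 1 w := by
    ext i j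
    simp [vecMulVec_apply]
  rw [hvec]
  apply isEigenprojection_of_mul_eq_zero
  · rw [vecMulVec_mul_vecMulVec, hw1, one_smul]
  · rw [mul_vecMulVec, hM, zero_vecMulVec]
  · rw [vecMulVec_mul, hw, vecMulVec_zero]
  · intro x hx
    obtain ⟨t, rfl⟩ := hker x hx
    rw [mulVec_smul, vecMulVec_mulVec, hw1]
    simp

/-- A Laplacian matrix annihilates the all-ones vector. -/
theorem IsLaplacian.mulVec_one {m : Type*} [Fintype m] [DecidableEq m] {L : Matrix m m ℝ}
    (hL : IsLaplacian L) : L *ᵥ 1 = 0 := by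
  ext i
  simpa [mulVec, dotProduct] using hL.2 i

/-- For a Laplacian matrix `L` and `c ≥ 0`, the matrix `1 + c • L` is strictly diagonally
dominant, hence invertible. -/
theorem IsLaplacian.isUnit_det_one_add_smul {m : Type*} [Fintype m] [DecidableEq m]
    {L : Matrix m m ℝ} (hL : IsLaplacian L) {c : ℝ} (hc : 0 ≤ c) :
    IsUnit (1 + c • L).det := by
  rw [isUnit_iff_ne_zero]
  apply det_ne_zero_of_sum_row_lt_diag
  intro i
  have hoff : ∑ j ∈ Finset.univ.erase i, ‖(1 + c • L) i j‖ = c * L i i := by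
    have hnorm : ∀ j ∈ Finset.univ.erase i, ‖(1 + c • L) i j‖ = -(c * L i j) := by
      intro j hj
      have hij : i ≠ j := (Finset.ne_of_mem_erase hj).symm
      simp only [Matrix.add_apply, one_apply_ne hij, Matrix.smul_apply, smul_eq_mul, zero_add, Real.norm_eq_abs]
      exact abs_of_nonpos (mul_nonpos_of_nonneg_of_nonpos hc (hL.1 i j hij))
    rw [Finset.sum_congr rfl hnorm, Finset.sum_neg_distrib, ← Finset.mul_sum]
    have hsum := Finset.add_sum_erase Finset.univ (L i) (Finset.mem_univ i)
    rw [hL.2 i] at hsum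
    rw [eq_neg_of_add_eq_zero_right hsum]
    ring
  rw [hoff]
  simp only [Matrix.add_apply, one_apply_eq, Matrix.smul_apply, smul_eq_mul, Real.norm_eq_abs]
  exact (lt_one_add _).trans_le (le_abs_self _)

/-- Lemma 1: the eigenprojection of the hub-augmented Laplacian `L₀ + H_{δ,v}`
is the rank-one matrix each of whose rows is
`(1/(s+δ)) ⬝ [vᵀ (I + (1/δ)L)⁻¹, δ]`. -/
theorem hub_eigenprojection {n : ℕ} (L : Matrix (Fin n) (Fin n) ℝ) (hL : IsLaplacian L)
    (v : Fin n → ℝ) (hv : ∀ i, 0 ≤ v i) (s : ℝ) (hs : s = ∑ i, v i)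
    (δ : ℝ) (hδ : 0 < δ)
    (L₀ HI Hv : Matrix (Fin n ⊕ Unit) (Fin n ⊕ Unit) ℝ)
    (hL₀ : L₀ = fromBlocks L 0 0 0)
    (hHI : HI = fromBlocks 1 (Matrix.of fun _ _ => (-1 : ℝ)) 0 0)
    (hHv : Hv = fromBlocks 0 0 (Matrix.of fun _ j => -v j) (Matrix.of fun _ _ => s)) :
    IsEigenprojection (L₀ + (δ • HI + Hv))
      (Matrix.of fun _ j =>
        (s + δ)⁻¹ * Sum.elim ((1 + δ⁻¹ • L)⁻¹.vecMul v) (fun _ => δ) j) := by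
  have hsδ : s + δ ≠ 0 := by
    have := Finset.sum_nonneg fun i (_ : i ∈ Finset.univ) => hv i
    rw [← hs] at this
    positivity
  have hA := hL.isUnit_det_one_add_smul (inv_nonneg.2 hδ.le)
  set A := 1 + δ⁻¹ • L with hAdef
  have hA1 : A *ᵥ 1 = 1 := by rw [hAdef, add_mulVec, smul_mulVec, hL.mulVec_one]; simp
  have hAinv1 : A⁻¹ *ᵥ 1 = 1 := by
    conv_lhs => rw [← hA1]
    rw [mulVec_mulVec, nonsing_inv_mul _ hA, one_mulVec]
  have hδA : L + δ • 1 = δ • A := by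
    rw [hAdef, smul_add, smul_smul, mul_inv_cancel₀ hδ.ne', one_smul, add_comm]
  have hvA1 : (v ᵥ* A⁻¹) ⬝ᵥ 1 = s := by
    rw [← dotProduct_mulVec, hAinv1, hs, dotProduct_one]
  have hM : L₀ + (δ • HI + Hv) = fromBlocks (δ • A) (Matrix.of fun _ _ => -δ)
      (Matrix.of fun _ j => -v j) (Matrix.of fun _ _ => s) := by
    rw [hL₀, hHI, hHv, fromBlocks_smul, fromBlocks_add, fromBlocks_add, ← hδA]
    congr 1 <;> ext i j <;> simp
  rw [hM]
  have hone : (1 : Fin n ⊕ Unit → ℝ) =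
      Sum.elim (1 : Fin n → ℝ) (1 : Unit → ℝ) := by ext (i | i) <;> rfl
  apply isEigenprojection_of_vecMul_eq_zero
    (w := fun j => (s + δ)⁻¹ * Sum.elim (v ᵥ* A⁻¹) (fun _ => δ) j)
  · rw [hone, fromBlocks_mulVec]
    have htop : (Matrix.of fun (_ : Fin n) (_ : Unit) => -δ) *ᵥ 1 = -(δ • 1) := by
      ext i
      simp [mulVec, dotProduct]
    ext (i | i)
    · simp [smul_mulVec, hA1, htop]
    · simp [mulVec, dotProduct, hs]
  · change ((s + δ)⁻¹ • Sum.elim (v ᵥ* A⁻¹) (fun _ => δ)) ᵥ* _ = 0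
    rw [smul_vecMul, vecMul_fromBlocks]
    have hleft : v ᵥ* A⁻¹ ᵥ* (δ • A) = δ • v := by
      rw [vecMul_smul, vecMul_vecMul, nonsing_inv_mul _ hA, vecMul_one]
    have hright : (v ᵥ* A⁻¹) ᵥ* (Matrix.of fun (_ : Fin n) (_ : Unit) => -δ) =
        fun _ => -(δ * s) := by
      ext j
      rw [← hvA1]
      simp [vecMul, dotProduct, Finset.mul_sum, mul_comm]
    rw [Sum.elim_comp_inl, Sum.elim_comp_inr, hleft, hright]
    ext (i | i) <;> simp [vecMul, dotProduct]
  · change ((s + δ)⁻¹ • Sum.elim (v ᵥ* A⁻¹) (fun _ => δ)) ⬝ᵥ _ = 1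
    rw [smul_dotProduct, hone, sumElim_dotProduct_sumElim, hvA1]
    simp [dotProduct, hsδ]
  · intro x hx
    set t := x (Sum.inr ()) with ht
    refine ⟨t, ?_⟩
    rw [fromBlocks_mulVec] at hx
    have hAx : A *ᵥ (x ∘ Sum.inl) = t • 1 := by
      ext i
      have hi := congrFun hx (Sum.inl i)
      have hi' : δ * (A *ᵥ (x ∘ Sum.inl)) i + -(δ * t) = 0 := by
        simpa [smul_mulVec, mulVec, dotProduct] using hi
      have := mul_left_cancel₀ hδ.ne' (add_neg_eq_zero.1 hi')
      simpa using this
    have hxl : x ∘ Sum.inl = t • 1 := by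
      rw [← one_mulVec (x ∘ Sum.inl), ← nonsing_inv_mul _ hA, ← mulVec_mulVec, hAx, mulVec_smul,
        hAinv1]
    ext (i | i)
    · exact congrFun hxl i
    · simp [ht]
end

section
/- Let L be an n×n real Laplacian matrix, let v ∈ ℝⁿ be a distribution vector (vᵢ ≥ 0 for all i and Σᵢ vᵢ = 1), let δ > 0, and set D = I − 𝟏vᵀ, where 𝟏 is the all-ones vector. Then the eigenprojection of L + δD at eigenvalue 0 equals 𝟏 vᵀ (I + (1/δ)L)^{−1}. -/
open Matrix Filter Topology

namespace IsLaplacian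

variable {m : Type*} [Fintype m] [DecidableEq m] {L : Matrix m m ℝ}

theorem mulVec_one_s3 (hL : IsLaplacian L) : L *ᵥ 1 = 0 := by
  ext i
  simpa [mulVec, dotProduct] using hL.2 i

theorem isUnit_one_add_smul (hL : IsLaplacian L) {c : ℝ} (hc : 0 ≤ c) :
    IsUnit (1 + c • L) := by
  rw [isUnit_iff_isUnit_det, isUnit_iff_ne_zero]
  refine det_ne_zero_of_sum_row_lt_diag fun k => ?_
  have hdiag : L k k = -∑ j ∈ Finset.univ.erase k, L k j := by
    have h := Finset.add_sum_erase Finset.univ (L k) (Finset.mem_univ k)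
    rw [hL.2 k] at h
    linarith
  have hoff : ∑ j ∈ Finset.univ.erase k, ‖(1 + c • L) k j‖ = c * L k k := by
    rw [hdiag, ← Finset.sum_neg_distrib, Finset.mul_sum]
    refine Finset.sum_congr rfl fun j hj => ?_
    have hkj : k ≠ j := (Finset.ne_of_mem_erase hj).symm
    have h : c * L k j ≤ 0 := mul_nonpos_of_nonneg_of_nonpos hc (hL.1 k j hkj)
    simp only [Matrix.add_apply, one_apply_ne hkj, Matrix.smul_apply, smul_eq_mul, zero_add,
      Real.norm_eq_abs, abs_of_nonpos h, mul_neg]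
  rw [hoff]
  refine lt_of_lt_of_le ?_ (Real.le_norm_self _)
  simp

end IsLaplacian

section Eigenprojection

variable {m : Type*} [Fintype m] [DecidableEq m] {M P : Matrix m m ℝ}

theorem add_pow_of_mul_eq_zero (hP : P * P = P) (hMP : M * P = 0) (hPM : P * M = 0) (k : ℕ) :
    (M + P) ^ (k + 1) = M ^ (k + 1) + P := by
  induction k with
  | zero => simp
  | succ k ih =>
    have h : M ^ (k + 1) * P = 0 := by rw [pow_succ, mul_assoc, hMP, mul_zero]
    rw [pow_succ, ih, add_mul, mul_add, mul_add, h, hPM, hP, ← pow_succ]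
    simp

/-- An idempotent `P` annihilating `M` on both sides, with `M + P` invertible, is the
eigenprojection of `M` at `0`. -/
theorem isEigenprojection_of_isUnit_add [Nonempty m] (hP : P * P = P) (hMP : M * P = 0)
    (hPM : P * M = 0) (hU : IsUnit (M + P)) : IsEigenprojection M P := by
  obtain ⟨k, hk⟩ := Nat.exists_eq_succ_of_ne_zero (Fintype.card_ne_zero (α := m))
  have hNP : M ^ (k + 1) * P = 0 := by rw [pow_succ, mul_assoc, hMP, mul_zero]
  have hPN : P * M ^ (k + 1) = 0 := by rw [pow_succ', ← mul_assoc, hPM, zero_mul]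
  have hU' : IsUnit (M ^ (k + 1) + P) := by
    rw [← add_pow_of_mul_eq_zero hP hMP hPM]
    exact hU.pow _
  rw [IsEigenprojection, hk]
  refine ⟨hP, ?_, ?_⟩ <;> generalize M ^ (k + 1) = N at *
  · ext x
    simp only [LinearMap.mem_range, LinearMap.mem_ker, mulVecLin_apply]
    constructor
    · rintro ⟨y, rfl⟩
      rw [mulVec_mulVec, hNP, zero_mulVec]
    · intro hx
      refine ⟨x, mulVec_injective_iff_isUnit.2 hU' ?_⟩
      simp only [mulVec_mulVec, add_mul, add_mulVec, hNP, hP, hx, zero_mulVec]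
  · ext x
    simp only [LinearMap.mem_range, LinearMap.mem_ker, mulVecLin_apply]
    constructor
    · intro hx
      obtain ⟨y, rfl⟩ := mulVec_surjective_iff_isUnit.2 hU' x
      have hy : P *ᵥ y = 0 := by
        rwa [mulVec_mulVec, mul_add, hPN, hP, zero_add] at hx
      exact ⟨y, by rw [add_mulVec, hy, add_zero]⟩
    · rintro ⟨y, rfl⟩
      rw [mulVec_mulVec, hPN, zero_mulVec]

/-- If `A` is invertible, `J` is idempotent and `A * J = J`, then `J * A⁻¹` is the eigenprojection
of `c • (A - J)` at `0` for every `c ≠ 0`. -/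
theorem isEigenprojection_smul_sub [Nonempty m] {A J : Matrix m m ℝ} (hA : IsUnit A)
    (hJ : J * J = J) (hAJ : A * J = J) {c : ℝ} (hc : c ≠ 0) :
    IsEigenprojection (c • (A - J)) (J * A⁻¹) := by
  have hdet : IsUnit A.det := (isUnit_iff_isUnit_det A).1 hA
  have hinvJ : A⁻¹ * J = J := by
    rw [← congrArg (A⁻¹ * ·) hAJ, nonsing_inv_mul_cancel_left _ _ hdet]
  have hP : J * A⁻¹ * (J * A⁻¹) = J * A⁻¹ := by
    rw [mul_assoc, ← mul_assoc A⁻¹, hinvJ, ← mul_assoc, hJ]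
  have hMP : c • (A - J) * (J * A⁻¹) = 0 := by
    rw [smul_mul_assoc, sub_mul, ← mul_assoc, ← mul_assoc, hAJ, hJ, sub_self, smul_zero]
  have hPM : J * A⁻¹ * (c • (A - J)) = 0 := by
    rw [mul_smul_comm, mul_sub, nonsing_inv_mul_cancel_right _ _ hdet, mul_assoc, hinvJ, hJ,
      sub_self, smul_zero]
  refine isEigenprojection_of_isUnit_add hP hMP hPM ?_
  rw [← mulVec_injective_iff_isUnit]
  refine (injective_iff_map_eq_zero (mulVecLin (c • (A - J) + J * A⁻¹))).2 fun x hx => ?_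
  rw [mulVecLin_apply] at hx
  have hPx : (J * A⁻¹) *ᵥ x = 0 := by
    have h := congrArg ((J * A⁻¹) *ᵥ ·) hx
    simpa only [mulVec_mulVec, mul_add, hPM, hP, zero_add, mulVec_zero] using h
  have hAx : A *ᵥ x = J *ᵥ x := by
    rw [add_mulVec, hPx, add_zero, smul_mulVec, smul_eq_zero_iff_right hc, sub_mulVec] at hx
    exact sub_eq_zero.1 hx
  have hx' : x = J *ᵥ x := by
    have h := congrArg (A⁻¹ *ᵥ ·) hAx
    simpa only [mulVec_mulVec, nonsing_inv_mul _ hdet, hinvJ, one_mulVec] using h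
  rw [hx', mulVec_mulVec, mul_assoc, hinvJ, hJ] at hPx
  rw [hx', hPx]

end Eigenprojection

/-- Lemma 3(1): the eigenprojection of `L + δ D` with `D = I − 𝟏vᵀ` equals
`𝟏 vᵀ (I + (1/δ)L)⁻¹`. -/
theorem background_eigenprojection {n : ℕ} (L : Matrix (Fin n) (Fin n) ℝ)
    (hL : IsLaplacian L) (v : Fin n → ℝ) (hv : ∀ i, 0 ≤ v i) (hv1 : ∑ i, v i = 1)
    (δ : ℝ) (hδ : 0 < δ)
    (D : Matrix (Fin n) (Fin n) ℝ) (hD : D = 1 - vecMulVec 1 v) :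
    IsEigenprojection (L + δ • D) (vecMulVec 1 v * (1 + δ⁻¹ • L)⁻¹) := by
  have : Nonempty (Fin n) := by
    by_contra h
    rw [not_nonempty_iff] at h
    simp at hv1
  have hM : L + δ • D = δ • ((1 + δ⁻¹ • L) - vecMulVec 1 v) := by
    rw [hD, add_sub_right_comm, smul_add, smul_inv_smul₀ hδ.ne', add_comm]
  rw [hM]
  refine isEigenprojection_smul_sub (hL.isUnit_one_add_smul (inv_nonneg.2 hδ.le)) ?_ ?_ hδ.ne'
  · rw [vecMulVec_mul_vecMulVec, dotProduct_one, hv1, one_smul]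
  · rw [mul_vecMulVec, add_mulVec, one_mulVec, smul_mulVec, hL.mulVec_one_s3, smul_zero, add_zero]
end

section
/- Let L be an n×n real Laplacian matrix with eigenprojection L^⊢ at eigenvalue 0. Then lim_{τ→∞} (I + τL)^{−1} = L^⊢ (entrywise convergence); equivalently, lim_{δ→0⁺} (I + (1/δ)L)^{−1} = L^⊢. -/
open Matrix Filter Topology

namespace IsLaplacian

variable {m : Type*} [Fintype m] [DecidableEq m] {L : Matrix m m ℝ}

/-- A Laplacian matrix is nonnegative at a maximal entry of a vector. -/
lemma mulVec_nonneg_of_forall_le (hL : IsLaplacian L) {y : m → ℝ} {i : m}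
    (hi : ∀ j, y j ≤ y i) : 0 ≤ (L *ᵥ y) i := by
  have h : (L *ᵥ y) i = ∑ j, L i j * (y j - y i) := by
    simp only [mul_sub, Finset.sum_sub_distrib, ← Finset.sum_mul, hL.2 i]
    simp [mulVec, dotProduct]
  rw [h]
  refine Finset.sum_nonneg fun j _ => ?_
  rcases eq_or_ne i j with rfl | hij
  · simp
  · exact mul_nonneg_of_nonpos_of_nonpos (hL.1 i j hij) (sub_nonpos.2 (hi j))

/-- For `τ ≥ 0`, the matrix `1 + τ • L` expands the sup norm. -/
lemma norm_le_norm_one_add_smul_mulVec (hL : IsLaplacian L) {τ : ℝ} (hτ : 0 ≤ τ) (y : m → ℝ) :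
    ‖y‖ ≤ ‖(1 + τ • L) *ᵥ y‖ := by
  cases isEmpty_or_nonempty m
  · simp [Subsingleton.elim y 0]
  obtain ⟨i, hi⟩ := Finite.exists_max fun j => |y j|
  have hy : ‖y‖ ≤ |y i| := (pi_norm_le_iff_of_nonneg (abs_nonneg _)).2 hi
  refine hy.trans (le_trans ?_ (norm_le_pi_norm _ i))
  have hc : ((1 + τ • L) *ᵥ y) i = y i + τ * (L *ᵥ y) i := by
    simp [add_mulVec, smul_mulVec]
  rw [hc, Real.norm_eq_abs]
  rcases le_total 0 (y i) with h0 | h0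
  · have h := hL.mulVec_nonneg_of_forall_le (y := y) (i := i)
      fun j => (le_abs_self _).trans ((hi j).trans_eq (abs_of_nonneg h0))
    have h' := mul_nonneg hτ h
    rw [abs_of_nonneg h0, abs_of_nonneg (by linarith)]
    linarith
  · have h := hL.mulVec_nonneg_of_forall_le (y := -y) (i := i)
      fun j => (neg_le_abs _).trans ((hi j).trans_eq (abs_of_nonpos h0))
    rw [mulVec_neg, Pi.neg_apply] at h
    have h' := mul_nonneg hτ h
    rw [abs_of_nonpos h0, abs_of_nonpos (by linarith)]
    linarith

lemma isUnit_det_one_add_smul_s13 (hL : IsLaplacian L) {τ : ℝ} (hτ : 0 ≤ τ) :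
    IsUnit (1 + τ • L).det := by
  rw [← isUnit_iff_isUnit_det, ← mulVec_injective_iff_isUnit]
  intro x y hxy
  have h := hL.norm_le_norm_one_add_smul_mulVec hτ (x - y)
  rw [mulVec_sub, sub_eq_zero.2 hxy, norm_zero] at h
  exact sub_eq_zero.1 (norm_le_zero_iff.1 h)

/-- For `τ ≥ 0`, the resolvent `(1 + τ • L)⁻¹` is a contraction in the sup norm. -/
lemma norm_inv_one_add_smul_mulVec_le (hL : IsLaplacian L) {τ : ℝ} (hτ : 0 ≤ τ) (x : m → ℝ) :
    ‖(1 + τ • L)⁻¹ *ᵥ x‖ ≤ ‖x‖ := by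
  have h := hL.norm_le_norm_one_add_smul_mulVec hτ ((1 + τ • L)⁻¹ *ᵥ x)
  rwa [mulVec_mulVec, mul_nonsing_inv _ (hL.isUnit_det_one_add_smul_s13 hτ), one_mulVec] at h

lemma mulVec_eq_zero_of_mulVec_mulVec_eq_zero (hL : IsLaplacian L) {x : m → ℝ}
    (hx : L *ᵥ (L *ᵥ x) = 0) : L *ᵥ x = 0 := by
  have hb : ∀ τ : ℝ, 0 ≤ τ → τ * ‖L *ᵥ x‖ ≤ 2 * ‖x‖ := by
    intro τ hτ
    have h := hL.norm_le_norm_one_add_smul_mulVec hτ (x - τ • L *ᵥ x)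
    have he : (1 + τ • L) *ᵥ (x - τ • L *ᵥ x) = x := by
      simp only [add_mulVec, smul_mulVec, mulVec_sub, mulVec_smul, hx, one_mulVec, smul_zero,
        add_zero, add_sub_cancel_right]
    rw [he] at h
    have h2 := norm_sub_le x (x - τ • L *ᵥ x)
    rw [sub_sub_cancel, norm_smul, Real.norm_of_nonneg hτ] at h2
    linarith
  by_contra hne
  have hpos : 0 < ‖L *ᵥ x‖ := norm_pos_iff.2 hne
  have h := hb ((2 * ‖x‖ + 1) / ‖L *ᵥ x‖) (by positivity)
  rw [div_mul_cancel₀ _ hpos.ne'] at h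
  linarith

/-- The eigenvalue `0` of a Laplacian matrix has index at most one. -/
lemma mulVec_eq_zero_of_pow_mulVec_eq_zero (hL : IsLaplacian L) {x : m → ℝ} (k : ℕ)
    (hx : L ^ (k + 1) *ᵥ x = 0) : L *ᵥ x = 0 := by
  induction k with
  | zero => simpa using hx
  | succ k ih =>
    refine ih ?_
    rw [pow_succ', ← mulVec_mulVec]
    apply hL.mulVec_eq_zero_of_mulVec_mulVec_eq_zero
    rwa [mulVec_mulVec, mulVec_mulVec, mul_assoc, ← pow_succ', ← pow_succ']

lemma tendsto_inv_one_add_smul_mulVec_mulVec (hL : IsLaplacian L) (z : m → ℝ) :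
    Tendsto (fun τ : ℝ => (1 + τ • L)⁻¹ *ᵥ (L *ᵥ z)) atTop (𝓝 0) := by
  have hlim : Tendsto (fun τ : ℝ => τ⁻¹ * (2 * ‖z‖)) atTop (𝓝 0) := by
    simpa using tendsto_inv_atTop_zero.mul_const (2 * ‖z‖)
  refine squeeze_zero_norm' ?_ hlim
  filter_upwards [eventually_gt_atTop 0] with τ hτ
  have he : (1 + τ • L)⁻¹ *ᵥ (L *ᵥ z) = τ⁻¹ • (z - (1 + τ • L)⁻¹ *ᵥ z) := by
    have h1 : (1 + τ • L)⁻¹ *ᵥ ((1 + τ • L) *ᵥ z) = z := by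
      simp [mulVec_mulVec, nonsing_inv_mul _ (hL.isUnit_det_one_add_smul_s13 hτ.le)]
    have h2 : L *ᵥ z = τ⁻¹ • ((1 + τ • L) *ᵥ z - z) := by
      simp [add_mulVec, smul_mulVec, smul_smul, hτ.ne']
    rw [h2, mulVec_smul, mulVec_sub, h1]
  rw [he, norm_smul, Real.norm_of_nonneg (inv_nonneg.2 hτ.le)]
  gcongr
  linarith [norm_sub_le z ((1 + τ • L)⁻¹ *ᵥ z), hL.norm_inv_one_add_smul_mulVec_le hτ.le z]

lemma tendsto_inv_one_add_smul_mulVec [Nonempty m] {P : Matrix m m ℝ} (hL : IsLaplacian L)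
    (hP : IsEigenprojection L P) (x : m → ℝ) :
    Tendsto (fun τ : ℝ => (1 + τ • L)⁻¹ *ᵥ x) atTop (𝓝 (P *ᵥ x)) := by
  obtain ⟨hidem, hrange, hker⟩ := hP
  obtain ⟨k, hk⟩ := Nat.exists_eq_add_one.2 (Fintype.card_pos (α := m))
  rw [hk] at hrange hker
  have hLP : L *ᵥ (P *ᵥ x) = 0 := by
    have h : P *ᵥ x ∈ LinearMap.ker (L ^ (k + 1)).mulVecLin := hrange ▸ ⟨x, rfl⟩
    exact hL.mulVec_eq_zero_of_pow_mulVec_eq_zero k h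
  have hmem : x - P *ᵥ x ∈ LinearMap.range (L ^ (k + 1)).mulVecLin := by
    rw [← hker, LinearMap.mem_ker, mulVecLin_apply, mulVec_sub, mulVec_mulVec, hidem, sub_self]
  obtain ⟨w, hw⟩ := hmem
  rw [mulVecLin_apply, pow_succ', ← mulVec_mulVec] at hw
  have h := (hL.tendsto_inv_one_add_smul_mulVec_mulVec (L ^ k *ᵥ w)).const_add (P *ᵥ x)
  rw [add_zero, hw] at h
  refine h.congr' ?_
  filter_upwards [eventually_ge_atTop 0] with τ hτ
  have hfix : (1 + τ • L)⁻¹ *ᵥ (P *ᵥ x) = P *ᵥ x := by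
    have h1 : (1 + τ • L) *ᵥ (P *ᵥ x) = P *ᵥ x := by
      simp only [add_mulVec, smul_mulVec, hLP, one_mulVec, smul_zero, add_zero]
    conv_lhs => rw [← h1]
    rw [mulVec_mulVec, nonsing_inv_mul _ (hL.isUnit_det_one_add_smul_s13 hτ), one_mulVec]
  rw [mulVec_sub, hfix, add_sub_cancel]

end IsLaplacian

/-- `(I + τL)⁻¹ → L^⊢` as `τ → ∞`; equivalently `(I + (1/δ)L)⁻¹ → L^⊢` as `δ → 0⁺`. -/
theorem resolvent_tendsto_eigenprojection {n : ℕ} (L P : Matrix (Fin n) (Fin n) ℝ)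
    (hL : IsLaplacian L) (hP : IsEigenprojection L P) :
    Tendsto (fun τ : ℝ => (1 + τ • L)⁻¹) atTop (𝓝 P) ∧
    Tendsto (fun δ : ℝ => (1 + δ⁻¹ • L)⁻¹) (𝓝[>] 0) (𝓝 P) := by
  have h : Tendsto (fun τ : ℝ => (1 + τ • L)⁻¹) atTop (𝓝 P) := by
    refine tendsto_pi_nhds.2 fun i => tendsto_pi_nhds.2 fun j => ?_
    have : Nonempty (Fin n) := ⟨i⟩
    simpa using tendsto_pi_nhds.1 (hL.tendsto_inv_one_add_smul_mulVec hP (Pi.single j 1)) i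
  exact ⟨h, h.comp tendsto_inv_nhdsGT_zero⟩
end
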